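/- arXiv:2310.17981 — 2 statements merged into one kernel-verified Lean document; each statement's English description precedes it below -/
import Mathlib

section
/- Assume in addition that for all v̄ ∈ V: ‖Φ_τ v̄‖ ≤ c_S ‖v̄‖ for all τ > 0, ‖Φ_a v̄ − Φ_b v̄‖ ≤ c_S (b−a)^β a^{−β} ‖v̄‖ for all 0 < a < b, and ‖Φ_τ v̄‖ ≤ c_S τ^{−β} ‖π v̄‖ for all τ > 0; assume moreover the second-order difference bound ‖π(G x₁ − G y₁ − G x₂ + G y₂)‖ ≤ L_G [ (‖ι(x₁−x₂)‖ + ‖ι(y₁−y₂)‖)·‖ι(x₁−y₁)‖ + (‖ι x₂‖ + ‖ι y₂‖)·‖ι(x₁ − y₁ − x₂ + y₂)‖ ] for all x₁, y₁, x₂, y₂ ∈ E. Let v : [0,T] → E be continuous with ‖v‖_{β,ρ,−β} < ∞. Then there exists a constant C, depending only on α and β, such that for all 0 ≤ s < r < t ≤ T, ‖ D_{s+}^α [τ ↦ Φ_{t−τ}(G(u(τ)) − G(v(τ)))] [r] ‖ ≤ C · c_S · L_G · (1 + ‖u‖_{β,−β} + ‖v‖_{β,−β}) · ‖u − v‖_{β,ρ,−β}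 · ( 1 + (t−r)^{−β} (r−s)^{β} ) · (r−s)^{−α} · e^{ρ r}. -/
/-- Left-sided Weyl fractional derivative of order `α` with base point `s₀`:
`D_{s₀+}^α Z[r] = (1/Γ(1−α)) ( Z(r)/(r−s₀)^α + α ∫_{s₀}^r (Z(r) − Z(q))/(r−q)^{1+α} dq )`. -/
noncomputable def weylD {V : Type*} [NormedAddCommGroup V] [NormedSpace ℝ V]
    (α s₀ : ℝ) (Z : ℝ → V) (r : ℝ) : V :=
  (Real.Gamma (1 - α))⁻¹ •
    ((((r - s₀) ^ α)⁻¹) • Z r +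
      α • ∫ q in s₀..r, (((r - q) ^ (1 + α))⁻¹) • (Z r - Z q))

/-- The weighted Hölder norm
`‖u‖_{β,ρ,−β} = sup_{t∈[0,T]} e^{−ρ t} ‖u(t)‖
  + sup_{0≤s<t≤T} e^{−ρ t} ‖ι(u(t)) − ι(u(s))‖ / (t−s)^β`. -/
noncomputable def hNorm {E F : Type*} [NormedAddCommGroup E] [NormedSpace ℝ E]
    [NormedAddCommGroup F] [NormedSpace ℝ F]
    (ι : E →L[ℝ] F) (β ρ T : ℝ) (u : ℝ → E) : ℝ :=
  sSup ((fun t => Real.exp (-(ρ * t)) * ‖u t‖) '' Set.Icc 0 T) +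
    sSup ((fun p : ℝ × ℝ =>
        Real.exp (-(ρ * p.2)) * ‖ι (u p.2) - ι (u p.1)‖ / (p.2 - p.1) ^ β) ''
      {p : ℝ × ℝ | 0 ≤ p.1 ∧ p.1 < p.2 ∧ p.2 ≤ T})

/-- Finiteness of the weighted Hölder norm `‖u‖_{β,ρ,−β}`. -/
def hFin {E F : Type*} [NormedAddCommGroup E] [NormedSpace ℝ E]
    [NormedAddCommGroup F] [NormedSpace ℝ F]
    (ι : E →L[ℝ] F) (β ρ T : ℝ) (u : ℝ → E) : Prop :=
  BddAbove ((fun t => Real.exp (-(ρ * t)) * ‖u t‖) '' Set.Icc 0 T) ∧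
    BddAbove ((fun p : ℝ × ℝ =>
        Real.exp (-(ρ * p.2)) * ‖ι (u p.2) - ι (u p.1)‖ / (p.2 - p.1) ^ β) ''
      {p : ℝ × ℝ | 0 ≤ p.1 ∧ p.1 < p.2 ∧ p.2 ≤ T})

section HolderNorm

variable {E F : Type*} [NormedAddCommGroup E] [NormedSpace ℝ E]
  [NormedAddCommGroup F] [NormedSpace ℝ F]

/-- A finite weighted Hölder norm splits into a bound for the values and a bound for the
increments whose constants add up to the norm. -/
lemma hFin.exists_bounds {ι : E →L[ℝ] F} {β ρ T : ℝ} {u : ℝ → E}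
    (h : hFin ι β ρ T u) :
    ∃ A B : ℝ, 0 ≤ A ∧ 0 ≤ B ∧ hNorm ι β ρ T u = A + B ∧
      (∀ t ∈ Set.Icc 0 T, ‖u t‖ ≤ A * Real.exp (ρ * t)) ∧
      ∀ q r : ℝ, 0 ≤ q → q < r → r ≤ T →
        ‖ι (u r) - ι (u q)‖ ≤ B * Real.exp (ρ * r) * (r - q) ^ β := by
  obtain ⟨hA, hB⟩ := h
  refine ⟨_, _, ?_, ?_, rfl, ?_, ?_⟩
  · apply Real.sSup_nonneg
    rintro _ ⟨t, -, rfl⟩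
    positivity
  · apply Real.sSup_nonneg
    rintro _ ⟨p, ⟨-, hp, -⟩, rfl⟩
    have := Real.rpow_nonneg (sub_pos.2 hp).le β
    positivity
  · intro t ht
    have h := le_csSup hA (Set.mem_image_of_mem _ ht)
    rw [Real.exp_neg, inv_mul_le_iff₀ (Real.exp_pos _)] at h
    exact h.trans_eq (mul_comm _ _)
  · intro q r hq hqr hr
    have h := le_csSup hB (Set.mem_image_of_mem _
      (show (q, r) ∈ {p : ℝ × ℝ | 0 ≤ p.1 ∧ p.1 < p.2 ∧ p.2 ≤ T} from ⟨hq, hqr, hr⟩))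
    have hpos := Real.rpow_pos_of_pos (sub_pos.2 hqr) β
    rw [div_le_iff₀ hpos, Real.exp_neg, inv_mul_le_iff₀ (Real.exp_pos _)] at h
    exact h.trans_eq (by ring)

end HolderNorm

/-- Bound for the Weyl derivative at `r` of a function that is `β`-Hölder at `r`. -/
lemma norm_weylD_le {V : Type*} [NormedAddCommGroup V] [NormedSpace ℝ V]
    {α β s r K H : ℝ} {Z : ℝ → V} (h0α : 0 < α) (hαβ : α < β) (hα1 : α < 1) (hsr : s < r)
    (hH : 0 ≤ H) (hZr : ‖Z r‖ ≤ K)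
    (hZ : ∀ q, s < q → q < r → ‖Z r - Z q‖ ≤ H * (r - q) ^ β) :
    ‖weylD α s Z r‖ ≤ (Real.Gamma (1 - α))⁻¹ *
      (K * (r - s) ^ (-α) + α / (β - α) * H * (r - s) ^ (β - α)) := by
  have hΓ : 0 < Real.Gamma (1 - α) := Real.Gamma_pos_of_pos (by linarith)
  have hrs : 0 < r - s := sub_pos.2 hsr
  have hexp : -1 < β - (1 + α) := by linarith
  have hpow : IntervalIntegrable (fun q => (r - q) ^ (β - (1 + α))) MeasureTheory.volume s r := by
    have h := (intervalIntegral.intervalIntegrable_rpow' (a := 0) (b := r - s) hexp).comp_sub_left r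
    simpa using h.symm
  have hint : ‖∫ q in s..r, (((r - q) ^ (1 + α))⁻¹) • (Z r - Z q)‖ ≤
      H * ((r - s) ^ (β - α) / (β - α)) := by
    have hval : ∫ q in s..r, H * (r - q) ^ (β - (1 + α)) =
        H * ((r - s) ^ (β - α) / (β - α)) := by
      rw [intervalIntegral.integral_const_mul,
        intervalIntegral.integral_comp_sub_left (fun x => x ^ (β - (1 + α))) r,
        integral_rpow (Or.inl hexp), sub_self, show β - (1 + α) + 1 = β - α by ring,
        Real.zero_rpow (by linarith), sub_zero]
    rw [← hval]
    refine intervalIntegral.norm_integral_le_of_norm_le hsr.le ?_ (hpow.const_mul H)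
    refine Filter.Eventually.of_forall fun q hq => ?_
    rcases hq.2.eq_or_lt with rfl | hqr
    · simp only [sub_self, smul_zero, norm_zero]
      positivity
    · have hrq : 0 < r - q := sub_pos.2 hqr
      rw [norm_smul, Real.norm_of_nonneg (by positivity), Real.rpow_sub hrq,
        inv_mul_le_iff₀ (by positivity)]
      calc ‖Z r - Z q‖ ≤ H * (r - q) ^ β := hZ q hq.1 hqr
        _ = _ := by field_simp
  have h1 : ‖(((r - s) ^ α)⁻¹) • Z r‖ ≤ K * (r - s) ^ (-α) := by
    rw [norm_smul, Real.norm_of_nonneg (by positivity), Real.rpow_neg hrs.le, mul_comm]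
    gcongr
  have h2 : ‖α • ∫ q in s..r, (((r - q) ^ (1 + α))⁻¹) • (Z r - Z q)‖ ≤
      α / (β - α) * H * (r - s) ^ (β - α) := by
    rw [norm_smul, Real.norm_of_nonneg h0α.le]
    calc _ ≤ α * (H * ((r - s) ^ (β - α) / (β - α))) := by gcongr
      _ = _ := by ring
  rw [weylD, norm_smul, Real.norm_of_nonneg (by positivity)]
  gcongr
  exact (norm_add_le _ _).trans (add_le_add h1 h2)

/-- Estimate of `‖D_{s+}^α [τ ↦ S(t−τ)(G(u(τ))−G(v(τ)))][r]‖` in the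
state-space norm, under the second-order difference bound on `G`: there is a constant
`C = C(α,β)` with bound
`C c_S L_G (1 + ‖u‖_{β,−β} + ‖v‖_{β,−β}) ‖u−v‖_{β,ρ,−β} (1 + (t−r)^{−β}(r−s)^β) (r−s)^{−α} e^{ρ r}`. -/
theorem weylD_semigroup_G_difference_bound_state
    {E F V W : Type*}
    [NormedAddCommGroup E] [NormedSpace ℝ E] [CompleteSpace E]
    [NormedAddCommGroup F] [NormedSpace ℝ F] [CompleteSpace F]
    [NormedAddCommGroup V] [NormedSpace ℝ V] [CompleteSpace V]
    [NormedAddCommGroup W] [NormedSpace ℝ W] [CompleteSpace W]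
    (ι : E →L[ℝ] F) (prj : V →L[ℝ] W)
    (hι : ∀ x : E, ‖ι x‖ ≤ ‖x‖) (hprj : ∀ v : V, ‖prj v‖ ≤ ‖v‖)
    (α β : ℝ) (h0α : 0 < α) (hαβ : α < β) (hβ1 : β < 1) :
    ∃ C : ℝ, 0 < C ∧
      ∀ (cS L_G ρ T : ℝ) (Φ : ℝ → V →L[ℝ] V) (G : E → V) (u v : ℝ → E),
        1 ≤ cS → 0 ≤ L_G → 0 ≤ ρ → 0 < T →
        (∀ w : V, ContinuousOn (fun τ => Φ τ w) (Set.Ioi 0)) →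
        (∀ τ : ℝ, 0 < τ → ∀ w : V, ‖Φ τ w‖ ≤ cS * ‖w‖) →
        (∀ a b : ℝ, 0 < a → a < b → ∀ w : V,
          ‖Φ a w - Φ b w‖ ≤ cS * (b - a) ^ β * a ^ (-β) * ‖w‖) →
        (∀ τ : ℝ, 0 < τ → ∀ w : V, ‖Φ τ w‖ ≤ cS * τ ^ (-β) * ‖prj w‖) →
        G 0 = 0 →
        (∀ x y : E, ‖G x - G y‖ ≤ L_G * ‖x - y‖) →
        (∀ x y : E, ‖prj (G x - G y)‖ ≤ L_G * ‖ι x - ι y‖) →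
        (∀ x₁ y₁ x₂ y₂ : E,
          ‖prj (G x₁ - G y₁ - G x₂ + G y₂)‖ ≤
            L_G * ((‖ι (x₁ - x₂)‖ + ‖ι (y₁ - y₂)‖) * ‖ι (x₁ - y₁)‖ +
              (‖ι x₂‖ + ‖ι y₂‖) * ‖ι (x₁ - y₁ - x₂ + y₂)‖)) →
        ContinuousOn u (Set.Icc 0 T) → ContinuousOn v (Set.Icc 0 T) →
        hFin ι β ρ T u → hFin ι β 0 T u →
        hFin ι β ρ T v → hFin ι β 0 T v →
        hFin ι β ρ T (fun x => u x - v x) →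
        ∀ s r t : ℝ, 0 ≤ s → s < r → r < t → t ≤ T →
          ‖weylD α s (fun τ => Φ (t - τ) (G (u τ) - G (v τ))) r‖ ≤
            C * cS * L_G * (1 + hNorm ι β 0 T u + hNorm ι β 0 T v) *
              hNorm ι β ρ T (fun x => u x - v x) *
              (1 + (t - r) ^ (-β) * (r - s) ^ β) * (r - s) ^ (-α) * Real.exp (ρ * r) := by
  have hΓ : 0 < Real.Gamma (1 - α) := Real.Gamma_pos_of_pos (by linarith)
  have hβα : 0 < β - α := sub_pos.2 hαβ
  refine ⟨(Real.Gamma (1 - α))⁻¹ * (1 + α / (β - α)), by positivity, ?_⟩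
  intro cS L_G ρ T Φ G u v hcS hLG hρ _ _ hΦ hΦdiff hΦprj _ hG _ hG2 _ _ _ hu _ hv hw
    s r t hs hsr hrt htT
  obtain ⟨Au, Bu, hAu, hBu, hNu, hu_val, hu_inc⟩ := hu.exists_bounds
  obtain ⟨Av, Bv, hAv, hBv, hNv, hv_val, hv_inc⟩ := hv.exists_bounds
  obtain ⟨A, B, hA, hB, hNw, hw_val, hw_inc⟩ := hw.exists_bounds
  simp only [zero_mul, Real.exp_zero, mul_one] at hu_val hu_inc hv_val hv_inc
  have hrs : 0 < r - s := sub_pos.2 hsr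
  have htr : 0 < t - r := sub_pos.2 hrt
  have hc0 : 0 ≤ cS := by linarith
  have hG_val : ∀ q, 0 ≤ q → q ≤ r → ‖G (u q) - G (v q)‖ ≤ L_G * (A * Real.exp (ρ * r)) := by
    intro q hq hqr
    calc _ ≤ L_G * ‖u q - v q‖ := hG _ _
      _ ≤ L_G * (A * Real.exp (ρ * q)) := by gcongr; exact hw_val q ⟨hq, by linarith⟩
      _ ≤ L_G * (A * Real.exp (ρ * r)) := by gcongr
  set K := cS * L_G * (1 + (Au + Bu) + (Av + Bv)) * (A + B) * Real.exp (ρ * r) with hK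
  have hK0 : 0 ≤ K := by positivity
  have hZr : ‖Φ (t - r) (G (u r) - G (v r))‖ ≤ K := by
    calc _ ≤ cS * (L_G * (A * Real.exp (ρ * r))) :=
          (hΦ _ htr _).trans (by gcongr; exact hG_val r (by linarith) le_rfl)
      _ = cS * L_G * 1 * A * Real.exp (ρ * r) := by ring
      _ ≤ K := by rw [hK]; gcongr <;> linarith
  have hZ : ∀ q, s < q → q < r →
      ‖Φ (t - r) (G (u r) - G (v r)) - Φ (t - q) (G (u q) - G (v q))‖ ≤
        K * (t - r) ^ (-β) * (r - q) ^ β := by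
    intro q hsq hqr
    have hq : 0 ≤ q := by linarith
    have hrT : r ≤ T := by linarith
    have hqT : q ∈ Set.Icc 0 T := ⟨hq, by linarith⟩
    have hrq : 0 < r - q := sub_pos.2 hqr
    have hsplit : Φ (t - r) (G (u r) - G (v r)) - Φ (t - q) (G (u q) - G (v q)) =
        Φ (t - r) (G (u r) - G (v r) - G (u q) + G (v q)) +
          (Φ (t - r) (G (u q) - G (v q)) - Φ (t - q) (G (u q) - G (v q))) := by
      simp only [map_sub, map_add]
      abel
    have hd := hΦdiff (t - r) (t - q) htr (by linarith) (G (u q) - G (v q))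
    rw [show t - q - (t - r) = r - q by ring] at hd
    have hιu : ‖ι (u r - u q)‖ ≤ Bu * (r - q) ^ β := by
      rw [map_sub]; exact hu_inc q r hq hqr hrT
    have hιv : ‖ι (v r - v q)‖ ≤ Bv * (r - q) ^ β := by
      rw [map_sub]; exact hv_inc q r hq hqr hrT
    have hιw : ‖ι (u r - v r - u q + v q)‖ ≤ B * Real.exp (ρ * r) * (r - q) ^ β := by
      rw [show u r - v r - u q + v q = (u r - v r) - (u q - v q) by abel, map_sub]
      exact hw_inc q r hq hqr hrT
    have hprjG : ‖prj (G (u r) - G (v r) - G (u q) + G (v q))‖ ≤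
        L_G * ((Bu * (r - q) ^ β + Bv * (r - q) ^ β) * (A * Real.exp (ρ * r)) +
          (Au + Av) * (B * Real.exp (ρ * r) * (r - q) ^ β)) := by
      refine (hG2 _ _ _ _).trans ?_
      gcongr
      · exact (hι _).trans (hw_val r ⟨by linarith, hrT⟩)
      · exact (hι _).trans (hu_val q hqT)
      · exact (hι _).trans (hv_val q hqT)
    rw [hsplit]
    calc _ ≤ cS * (t - r) ^ (-β) *
            (L_G * ((Bu * (r - q) ^ β + Bv * (r - q) ^ β) * (A * Real.exp (ρ * r)) +
              (Au + Av) * (B * Real.exp (ρ * r) * (r - q) ^ β))) +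
          cS * (r - q) ^ β * (t - r) ^ (-β) * (L_G * (A * Real.exp (ρ * r))) := by
          refine (norm_add_le _ _).trans (add_le_add ((hΦprj _ htr _).trans ?_) (hd.trans ?_))
          · gcongr
          · gcongr
            exact hG_val q hq hqr.le
      _ = cS * L_G * Real.exp (ρ * r) * (t - r) ^ (-β) * (r - q) ^ β *
            ((Bu + Bv) * A + (Au + Av) * B + A) := by ring
      _ ≤ cS * L_G * Real.exp (ρ * r) * (t - r) ^ (-β) * (r - q) ^ β *
            ((1 + (Au + Bu) + (Av + Bv)) * (A + B)) := by
          gcongr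
          have : 0 ≤ Bu * B + Bv * B + Au * A + Av * A + B := by positivity
          linarith
      _ = _ := by rw [hK]; ring
  refine (norm_weylD_le h0α hαβ (by linarith) hsr (by positivity) hZr hZ).trans ?_
  rw [hNu, hNv, hNw, show β - α = β + -α by ring, Real.rpow_add hrs, ← sub_eq_add_neg]
  set X := (t - r) ^ (-β) * (r - s) ^ β with hX
  have hX0 : 0 ≤ X := by positivity
  set c := α / (β - α) with hc
  have hcpos : 0 ≤ c := by positivity
  calc _ = (Real.Gamma (1 - α))⁻¹ * (K * (r - s) ^ (-α) * (1 + c * X)) := by rw [hX]; ring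
    _ ≤ (Real.Gamma (1 - α))⁻¹ * (K * (r - s) ^ (-α) * ((1 + c) * (1 + X))) := by
        gcongr
        linarith
    _ = _ := by rw [hK]; ring
end

section
/- Assume in addition the semigroup law Φ_{a+b} = Φ_a ∘ Φ_b for all a, b > 0, fix α' with α < α' < 1, and assume for all v̄ ∈ V: ‖Φ_τ v̄‖ ≤ c_S ‖v̄‖ for all τ > 0; ‖Φ_τ v̄‖ ≤ c_S τ^{−β} ‖π v̄‖ for all τ > 0; ‖π(Φ_δ v̄ − v̄)‖ ≤ c_S δ^β ‖v̄‖ for all δ > 0; and ‖Φ_a v̄ − Φ_{a+b} v̄‖ ≤ c_S a^{−α'} b^{α'} ‖v̄‖ for all a, b > 0; assume moreover the second-order difference bound ‖π(G x₁ − G y₁ − G x₂ + G y₂)‖ ≤ L_G [ (‖ι(x₁−x₂)‖ + ‖ι(y₁−y₂)‖)·‖ι(x₁−y₁)‖ + (‖ι x₂‖ + ‖ι y₂‖)·‖ι(x₁ − y₁ − x₂ + y₂)‖ ] for all x₁, y₁, x₂, y₂ ∈ E. Let v : [0,T] → E be continuous with ‖v‖_{β,ρ,−β} < ∞. Then there exists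 a constant C, depending only on α, α' and β, such that for all 0 < r < s < t ≤ T, ‖π( D_{0+}^α [τ ↦ Φ_{t−τ}(G(u(τ)) − G(v(τ))) − Φ_{s−τ}(G(u(τ)) − G(v(τ)))] [r] )‖ ≤ C · c_S² · L_G · (1 + ‖u‖_{β,−β} + ‖v‖_{β,−β}) · ‖u − v‖_{β,ρ,−β} · e^{ρ r} · (t−s)^β · ( r^{−α} + (s−r)^{−α'} r^{α'−α} + (s−r)^{−β} r^{β−α} ). -/
/-- If a function vanishes at `r` like a sum of two powers larger than `α`, the singular integral
in the Weyl derivative is controlled by the corresponding explicit integrals. -/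
theorem norm_apply_weylD_le {V W : Type*}
    [NormedAddCommGroup V] [NormedSpace ℝ V] [CompleteSpace V]
    [NormedAddCommGroup W] [NormedSpace ℝ W] [CompleteSpace W]
    (L : V →L[ℝ] W) {α γ β s₀ r K A B : ℝ} (hα : 0 < α) (hα1 : α < 1)
    (hγ : α < γ) (hβ : α < β) (hr : s₀ < r) (Z : ℝ → V)
    (hZ : ‖L (Z r)‖ ≤ K)
    (hinc : ∀ q, s₀ < q → q < r → ‖L (Z r - Z q)‖ ≤ A * (r - q) ^ γ + B * (r - q) ^ β) :
    ‖L (weylD α s₀ Z r)‖ ≤ (Real.Gamma (1 - α))⁻¹ *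
      (K * (r - s₀) ^ (-α) + α * (A * ((r - s₀) ^ (γ - α) / (γ - α)) +
        B * ((r - s₀) ^ (β - α) / (β - α)))) := by
  have hΓ : 0 < Real.Gamma (1 - α) := Real.Gamma_pos_of_pos (by linarith)
  have hrs : 0 < r - s₀ := sub_pos.2 hr
  have hpow : ∀ δ : ℝ, α < δ →
      IntervalIntegrable (fun q => (r - q) ^ (δ - 1 - α)) MeasureTheory.volume s₀ r := by
    intro δ hδ
    have h := (intervalIntegral.intervalIntegrable_rpow' (a := 0) (b := r - s₀)
      (r := δ - 1 - α) (by linarith)).comp_sub_left r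
    simpa using h.symm
  have hval : ∀ δ : ℝ, α < δ →
      ∫ q in s₀..r, (r - q) ^ (δ - 1 - α) = (r - s₀) ^ (δ - α) / (δ - α) := by
    intro δ hδ
    rw [intervalIntegral.integral_comp_sub_left (fun x : ℝ => x ^ (δ - 1 - α)) r, sub_self,
      integral_rpow (Or.inl (by linarith)), show δ - 1 - α + 1 = δ - α by ring,
      Real.zero_rpow (by linarith), sub_zero]
  set f : ℝ → V := fun q => (((r - q) ^ (1 + α))⁻¹) • (Z r - Z q) with hf
  set g : ℝ → ℝ := fun q => A * (r - q) ^ (γ - 1 - α) + B * (r - q) ^ (β - 1 - α) with hg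
  have hgint : IntervalIntegrable g MeasureTheory.volume s₀ r :=
    ((hpow γ hγ).const_mul A).add ((hpow β hβ).const_mul B)
  have hgval : ∫ q in s₀..r, g q =
      A * ((r - s₀) ^ (γ - α) / (γ - α)) + B * ((r - s₀) ^ (β - α) / (β - α)) := by
    rw [hg, intervalIntegral.integral_add ((hpow γ hγ).const_mul A) ((hpow β hβ).const_mul B),
      intervalIntegral.integral_const_mul, intervalIntegral.integral_const_mul,
      hval γ hγ, hval β hβ]
  have hfg : ∀ q, s₀ < q → q < r → ‖L (f q)‖ ≤ g q := by
    intro q hq hqr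
    have hp : 0 < r - q := sub_pos.2 hqr
    have hexp : ∀ δ : ℝ, (r - q) ^ (δ - 1 - α) = ((r - q) ^ (1 + α))⁻¹ * (r - q) ^ δ := by
      intro δ
      rw [← Real.rpow_neg hp.le, ← Real.rpow_add hp]
      congr 1
      ring
    have hinv : 0 ≤ ((r - q) ^ (1 + α))⁻¹ := by positivity
    calc ‖L (f q)‖ = ((r - q) ^ (1 + α))⁻¹ * ‖L (Z r - Z q)‖ := by
          rw [hf, map_smul, norm_smul, Real.norm_of_nonneg hinv]
      _ ≤ ((r - q) ^ (1 + α))⁻¹ * (A * (r - q) ^ γ + B * (r - q) ^ β) :=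
          mul_le_mul_of_nonneg_left (hinc q hq hqr) hinv
      _ = g q := by
          simp only [hg, hexp]
          ring
  have hle : ∀ᵐ q, q ∈ Set.Ioc s₀ r → ‖L (f q)‖ ≤ g q := by
    filter_upwards [MeasureTheory.compl_mem_ae_iff.2 (MeasureTheory.measure_singleton r)]
      with q hne hq
    exact hfg q hq.1 (lt_of_le_of_ne hq.2 hne)
  have hint : ‖L (∫ q in s₀..r, f q)‖ ≤ ∫ q in s₀..r, g q := by
    have hbound := intervalIntegral.norm_integral_le_of_norm_le hr.le hle hgint
    by_cases hi : IntervalIntegrable f MeasureTheory.volume s₀ r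
    · rwa [← L.intervalIntegral_comp_comm hi]
    · rw [intervalIntegral.integral_undef hi, map_zero, norm_zero]
      exact (norm_nonneg _).trans hbound
  rw [hgval] at hint
  have hinv : 0 ≤ ((r - s₀) ^ α)⁻¹ := by positivity
  unfold weylD
  rw [map_smul, norm_smul, Real.norm_of_nonneg (inv_nonneg.2 hΓ.le)]
  refine mul_le_mul_of_nonneg_left ?_ (inv_nonneg.2 hΓ.le)
  rw [map_add, map_smul, map_smul]
  refine (norm_add_le _ _).trans (add_le_add ?_ ?_)
  · rw [norm_smul, Real.norm_of_nonneg hinv, Real.rpow_neg hrs.le, mul_comm]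
    exact mul_le_mul_of_nonneg_right hZ hinv
  · rw [norm_smul, Real.norm_of_nonneg hα.le]
    exact mul_le_mul_of_nonneg_left hint hα.le

theorem sSup_weighted_norm_nonneg {E : Type*} [NormedAddCommGroup E] {ρ T : ℝ} {u : ℝ → E} :
    0 ≤ sSup ((fun t => Real.exp (-(ρ * t)) * ‖u t‖) '' Set.Icc 0 T) := by
  refine Real.sSup_nonneg ?_
  rintro _ ⟨t, -, rfl⟩
  positivity

section HolderNorm

variable {E F : Type*} [NormedAddCommGroup E] [NormedSpace ℝ E]
  [NormedAddCommGroup F] [NormedSpace ℝ F] {ι : E →L[ℝ] F} {β ρ T : ℝ} {u : ℝ → E}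

theorem sSup_weighted_holder_nonneg :
    0 ≤ sSup ((fun p : ℝ × ℝ =>
        Real.exp (-(ρ * p.2)) * ‖ι (u p.2) - ι (u p.1)‖ / (p.2 - p.1) ^ β) ''
      {p : ℝ × ℝ | 0 ≤ p.1 ∧ p.1 < p.2 ∧ p.2 ≤ T}) := by
  refine Real.sSup_nonneg ?_
  rintro _ ⟨p, ⟨-, hp, -⟩, rfl⟩
  have : 0 < p.2 - p.1 := sub_pos.2 hp
  positivity

theorem hNorm_nonneg : 0 ≤ hNorm ι β ρ T u :=
  add_nonneg sSup_weighted_norm_nonneg sSup_weighted_holder_nonneg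

theorem hFin.norm_le (h : hFin ι β ρ T u) {t : ℝ} (h0 : 0 ≤ t) (hT : t ≤ T) :
    ‖u t‖ ≤ Real.exp (ρ * t) * hNorm ι β ρ T u := by
  have h1 : Real.exp (-(ρ * t)) * ‖u t‖ ≤ hNorm ι β ρ T u :=
    (le_csSup h.1 ⟨t, ⟨h0, hT⟩, rfl⟩).trans (le_add_of_nonneg_right sSup_weighted_holder_nonneg)
  rwa [Real.exp_neg, inv_mul_le_iff₀ (Real.exp_pos _)] at h1

theorem hFin.norm_sub_le (h : hFin ι β ρ T u) {s t : ℝ} (h0 : 0 ≤ s) (hst : s < t)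
    (hT : t ≤ T) :
    ‖ι (u t) - ι (u s)‖ ≤ Real.exp (ρ * t) * hNorm ι β ρ T u * (t - s) ^ β := by
  have h1 : Real.exp (-(ρ * t)) * ‖ι (u t) - ι (u s)‖ / (t - s) ^ β ≤ hNorm ι β ρ T u :=
    (le_csSup h.2 ⟨(s, t), ⟨h0, hst, hT⟩, rfl⟩).trans
      (le_add_of_nonneg_left sSup_weighted_norm_nonneg)
  have hts : 0 < t - s := sub_pos.2 hst
  rw [div_le_iff₀ (by positivity), Real.exp_neg, inv_mul_le_iff₀ (Real.exp_pos _)] at h1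
  rwa [mul_assoc]

end HolderNorm

/-- Second-order difference estimate for `G` along two Hölder paths. -/
theorem norm_second_difference_le {E F V W : Type*}
    [NormedAddCommGroup E] [NormedSpace ℝ E] [NormedAddCommGroup F] [NormedSpace ℝ F]
    [NormedAddCommGroup V] [NormedSpace ℝ V] [NormedAddCommGroup W] [NormedSpace ℝ W]
    {ι : E →L[ℝ] F} {prj : V →L[ℝ] W} (hι : ∀ x : E, ‖ι x‖ ≤ ‖x‖)
    {β ρ T L_G : ℝ} {G : E → V} {u v : ℝ → E} (hL : 0 ≤ L_G)
    (hG2 : ∀ x₁ y₁ x₂ y₂ : E,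
      ‖prj (G x₁ - G y₁ - G x₂ + G y₂)‖ ≤
        L_G * ((‖ι (x₁ - x₂)‖ + ‖ι (y₁ - y₂)‖) * ‖ι (x₁ - y₁)‖ +
          (‖ι x₂‖ + ‖ι y₂‖) * ‖ι (x₁ - y₁ - x₂ + y₂)‖))
    (hu : hFin ι β 0 T u) (hv : hFin ι β 0 T v)
    (huv : hFin ι β ρ T (fun x => u x - v x))
    {q r : ℝ} (hq : 0 ≤ q) (hqr : q < r) (hrT : r ≤ T) :
    ‖prj (G (u r) - G (v r) - (G (u q) - G (v q)))‖ ≤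
      2 * L_G * (hNorm ι β 0 T u + hNorm ι β 0 T v) *
        (Real.exp (ρ * r) * hNorm ι β ρ T (fun x => u x - v x)) * (r - q) ^ β := by
  have hr : 0 ≤ r := hq.trans hqr.le
  have hqT : q ≤ T := hqr.le.trans hrT
  have hp : 0 < r - q := sub_pos.2 hqr
  have hpow : 0 ≤ (r - q) ^ β := by positivity
  have hu0 : ‖ι (u q)‖ ≤ hNorm ι β 0 T u := by
    simpa using (hι _).trans (hu.norm_le hq hqT)
  have hv0 : ‖ι (v q)‖ ≤ hNorm ι β 0 T v := by
    simpa using (hι _).trans (hv.norm_le hq hqT)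
  have hu1 : ‖ι (u r - u q)‖ ≤ hNorm ι β 0 T u * (r - q) ^ β := by
    simpa using hu.norm_sub_le hq hqr hrT
  have hv1 : ‖ι (v r - v q)‖ ≤ hNorm ι β 0 T v * (r - q) ^ β := by
    simpa using hv.norm_sub_le hq hqr hrT
  have hd0 := (hι _).trans (huv.norm_le hr hrT)
  have hd1 := huv.norm_sub_le hq hqr hrT
  rw [← map_sub, show u r - v r - (u q - v q) = u r - v r - u q + v q by abel] at hd1
  have hNu : 0 ≤ hNorm ι β 0 T u := hNorm_nonneg
  have hNv : 0 ≤ hNorm ι β 0 T v := hNorm_nonneg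
  rw [show G (u r) - G (v r) - (G (u q) - G (v q)) = G (u r) - G (v r) - G (u q) + G (v q) by abel]
  refine (hG2 _ _ _ _).trans ?_
  have h1 := mul_le_mul (add_le_add hu1 hv1) hd0 (norm_nonneg _) (by positivity)
  have h2 := mul_le_mul (add_le_add hu0 hv0) hd1 (norm_nonneg _) (by positivity)
  refine (mul_le_mul_of_nonneg_left (add_le_add h1 h2) hL).trans (le_of_eq ?_)
  ring

/-- Estimate of
`‖π(D_{0+}^α [τ ↦ (S(t−τ)−S(s−τ))(G(u(τ))−G(v(τ)))][r])‖`, under the second-order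
difference bound on `G`: there is a constant `C = C(α,α',β)` with bound
`C c_S² L_G (1 + ‖u‖_{β,−β} + ‖v‖_{β,−β}) ‖u−v‖_{β,ρ,−β} e^{ρ r} (t−s)^β
  ( r^{−α} + (s−r)^{−α'} r^{α'−α} + (s−r)^{−β} r^{β−α} )`. -/
theorem weylD_semigroup_difference_G_difference_bound
    {E F V W : Type*}
    [NormedAddCommGroup E] [NormedSpace ℝ E] [CompleteSpace E]
    [NormedAddCommGroup F] [NormedSpace ℝ F] [CompleteSpace F]
    [NormedAddCommGroup V] [NormedSpace ℝ V] [CompleteSpace V]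
    [NormedAddCommGroup W] [NormedSpace ℝ W] [CompleteSpace W]
    (ι : E →L[ℝ] F) (prj : V →L[ℝ] W)
    (hι : ∀ x : E, ‖ι x‖ ≤ ‖x‖) (hprj : ∀ v : V, ‖prj v‖ ≤ ‖v‖)
    (α α' β : ℝ) (h0α : 0 < α) (hαα' : α < α') (hα'1 : α' < 1)
    (hαβ : α < β) (hβ1 : β < 1) :
    ∃ C : ℝ, 0 < C ∧
      ∀ (cS L_G ρ T : ℝ) (Φ : ℝ → V →L[ℝ] V) (G : E → V) (u v : ℝ → E),
        1 ≤ cS → 0 ≤ L_G → 0 ≤ ρ → 0 < T →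
        (∀ w : V, ContinuousOn (fun τ => Φ τ w) (Set.Ioi 0)) →
        (∀ a b : ℝ, 0 < a → 0 < b → ∀ w : V, Φ (a + b) w = Φ a (Φ b w)) →
        (∀ τ : ℝ, 0 < τ → ∀ w : V, ‖Φ τ w‖ ≤ cS * ‖w‖) →
        (∀ τ : ℝ, 0 < τ → ∀ w : V, ‖Φ τ w‖ ≤ cS * τ ^ (-β) * ‖prj w‖) →
        (∀ δ : ℝ, 0 < δ → ∀ w : V, ‖prj (Φ δ w - w)‖ ≤ cS * δ ^ β * ‖w‖) →
        (∀ a b : ℝ, 0 < a → 0 < b → ∀ w : V,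
          ‖Φ a w - Φ (a + b) w‖ ≤ cS * a ^ (-α') * b ^ α' * ‖w‖) →
        G 0 = 0 →
        (∀ x y : E, ‖G x - G y‖ ≤ L_G * ‖x - y‖) →
        (∀ x y : E, ‖prj (G x - G y)‖ ≤ L_G * ‖ι x - ι y‖) →
        (∀ x₁ y₁ x₂ y₂ : E,
          ‖prj (G x₁ - G y₁ - G x₂ + G y₂)‖ ≤
            L_G * ((‖ι (x₁ - x₂)‖ + ‖ι (y₁ - y₂)‖) * ‖ι (x₁ - y₁)‖ +
              (‖ι x₂‖ + ‖ι y₂‖) * ‖ι (x₁ - y₁ - x₂ + y₂)‖)) →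
        ContinuousOn u (Set.Icc 0 T) → ContinuousOn v (Set.Icc 0 T) →
        hFin ι β ρ T u → hFin ι β 0 T u →
        hFin ι β ρ T v → hFin ι β 0 T v →
        hFin ι β ρ T (fun x => u x - v x) →
        ∀ r s t : ℝ, 0 < r → r < s → s < t → t ≤ T →
          ‖prj (weylD α 0
              (fun τ => Φ (t - τ) (G (u τ) - G (v τ)) -
                Φ (s - τ) (G (u τ) - G (v τ))) r)‖ ≤
            C * cS ^ 2 * L_G * (1 + hNorm ι β 0 T u + hNorm ι β 0 T v) *
              hNorm ι β ρ T (fun x => u x - v x) * Real.exp (ρ * r) * (t - s) ^ β *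
              (r ^ (-α) + (s - r) ^ (-α') * r ^ (α' - α) +
                (s - r) ^ (-β) * r ^ (β - α)) := by
  have hα1 : α < 1 := hαβ.trans hβ1
  have hΓ : 0 < Real.Gamma (1 - α) := Real.Gamma_pos_of_pos (by linarith)
  have hγ : 0 < α' - α := sub_pos.2 hαα'
  have hβα : 0 < β - α := sub_pos.2 hαβ
  refine ⟨(Real.Gamma (1 - α))⁻¹ * (1 + α / (α' - α) + 2 * α / (β - α)), by positivity, ?_⟩
  intro cS L_G ρ T Φ G u v hcS hL hρ hT _ hsemi hbdd hsmooth htime hhol _ hG1 _ hG2 _ _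
    _ hu _ hv huv r s t hr hrs hst htT
  set Nu := hNorm ι β 0 T u with hNu_def
  set Nv := hNorm ι β 0 T v with hNv_def
  set N := hNorm ι β ρ T (fun x => u x - v x) with hN_def
  have hNu : 0 ≤ Nu := hNorm_nonneg
  have hNv : 0 ≤ Nv := hNorm_nonneg
  have hN : 0 ≤ N := hNorm_nonneg
  have hcS0 : 0 ≤ cS := zero_le_one.trans hcS
  have hΔ : 0 < t - s := sub_pos.2 hst
  have hsr : 0 < s - r := sub_pos.2 hrs
  have hrT : r ≤ T := by linarith
  have hexp : 0 < Real.exp (ρ * r) := Real.exp_pos _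
  set e := Real.exp (ρ * r) with he
  set D := (t - s) ^ β with hD
  have hD0 : 0 < D := by positivity
  set P := (s - r) ^ (-α') with hP
  set Q := (s - r) ^ (-β) with hQ
  have hP0 : 0 < P := by positivity
  have hQ0 : 0 < Q := by positivity
  have hd : ∀ q, 0 ≤ q → q ≤ r → ‖G (u q) - G (v q)‖ ≤ L_G * (e * N) := by
    intro q hq hqr
    have h1 : Real.exp (ρ * q) ≤ e := Real.exp_le_exp.2 (mul_le_mul_of_nonneg_left hqr hρ)
    calc ‖G (u q) - G (v q)‖ ≤ L_G * ‖u q - v q‖ := hG1 _ _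
      _ ≤ L_G * (Real.exp (ρ * q) * N) :=
          mul_le_mul_of_nonneg_left (huv.norm_le hq (hqr.trans hrT)) hL
      _ ≤ L_G * (e * N) := by gcongr
  have hfac : ∀ q, q ≤ r → ∀ w, Φ (t - q) w = Φ (t - s) (Φ (s - q) w) := by
    intro q hq w
    rw [← hsemi (t - s) (s - q) hΔ (by linarith) w]
    congr 2
    ring
  set Z : ℝ → V := fun τ => Φ (t - τ) (G (u τ) - G (v τ)) - Φ (s - τ) (G (u τ) - G (v τ))
    with hZ_def
  set K := cS ^ 2 * L_G * (1 + Nu + Nv) * N * e * D with hK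
  have hK0 : 0 ≤ K := by positivity
  have hbase : cS * D * (cS * (L_G * (e * N))) ≤ K := by
    have h1 : 0 ≤ cS ^ 2 * L_G * N * e * D * (Nu + Nv) := by positivity
    rw [hK]
    linarith
  have hZr : ‖prj (Z r)‖ ≤ K := by
    simp only [hZ_def]
    rw [hfac r le_rfl]
    refine (htime _ hΔ _).trans (le_trans ?_ hbase)
    exact mul_le_mul_of_nonneg_left ((hbdd _ hsr _).trans
      (mul_le_mul_of_nonneg_left (hd r hr.le le_rfl) hcS0)) (by positivity)
  have hinc : ∀ q, 0 < q → q < r →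
      ‖prj (Z r - Z q)‖ ≤ K * P * (r - q) ^ α' + 2 * K * Q * (r - q) ^ β := by
    intro q hq hqr
    have hp : 0 < r - q := sub_pos.2 hqr
    set x := G (u r) - G (v r) with hx
    set y := G (u q) - G (v q) with hy
    have hsplit : Φ (s - r) x - Φ (s - q) y =
        (Φ (s - r) y - Φ ((s - r) + (r - q)) y) + Φ (s - r) (x - y) := by
      rw [show s - r + (r - q) = s - q by ring, map_sub (Φ (s - r)) x y]
      abel
    have h1 : ‖Φ (s - r) y - Φ ((s - r) + (r - q)) y‖ ≤
        cS * P * (r - q) ^ α' * (L_G * (e * N)) :=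
      (hhol _ _ hsr hp y).trans (mul_le_mul_of_nonneg_left (hd q hq.le hqr.le) (by positivity))
    have h2 : ‖Φ (s - r) (x - y)‖ ≤
        cS * Q * (2 * L_G * (Nu + Nv) * (e * N) * (r - q) ^ β) :=
      (hsmooth _ hsr _).trans (mul_le_mul_of_nonneg_left
        (norm_second_difference_le hι hL hG2 hu hv huv hq.le hqr hrT) (by positivity))
    have hZZ : Z r - Z q = Φ (t - s) (Φ (s - r) x - Φ (s - q) y) -
        (Φ (s - r) x - Φ (s - q) y) := by
      simp only [hZ_def]
      rw [hfac r le_rfl, hfac q hqr.le, map_sub (Φ (t - s))]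
      abel
    rw [hZZ]
    refine (htime _ hΔ _).trans ?_
    rw [← hD]
    have h3 : ‖Φ (s - r) x - Φ (s - q) y‖ ≤ cS * P * (r - q) ^ α' * (L_G * (e * N)) +
        cS * Q * (2 * L_G * (Nu + Nv) * (e * N) * (r - q) ^ β) := by
      rw [hsplit]
      exact (norm_add_le _ _).trans (add_le_add h1 h2)
    refine (mul_le_mul_of_nonneg_left h3 (by positivity)).trans ?_
    have h4 : cS * D * (cS * (L_G * (e * N))) * (P * (r - q) ^ α') ≤ K * (P * (r - q) ^ α') :=
      mul_le_mul_of_nonneg_right hbase (by positivity)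
    have h5 : 0 ≤ cS ^ 2 * L_G * N * e * D * Q * (r - q) ^ β := by positivity
    have h6 : 2 * K * Q * (r - q) ^ β =
        2 * (cS ^ 2 * L_G * N * e * D * Q * (r - q) ^ β) * (Nu + Nv) +
          2 * (cS ^ 2 * L_G * N * e * D * Q * (r - q) ^ β) := by
      rw [hK]
      ring
    linarith
  have hmain := norm_apply_weylD_le prj h0α hα1 hαα' hαβ hr Z hZr hinc
  rw [sub_zero] at hmain
  refine hmain.trans ?_
  set R₀ := r ^ (-α) with hR₀
  set R₁ := r ^ (α' - α) with hR₁
  set R₂ := r ^ (β - α) with hR₂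
  have hR₀0 : 0 < R₀ := by positivity
  have hR₁0 : 0 < R₁ := by positivity
  have hR₂0 : 0 < R₂ := by positivity
  set a := α / (α' - α) with ha
  set b := 2 * α / (β - α) with hb
  have ha0 : 0 < a := by positivity
  have hb0 : 0 < b := by positivity
  have hsum : K * R₀ + α * (K * P * (R₁ / (α' - α)) + 2 * K * Q * (R₂ / (β - α))) =
      K * (R₀ + a * (P * R₁) + b * (Q * R₂)) := by
    rw [ha, hb]
    ring
  rw [hsum]
  have hcmp : R₀ + a * (P * R₁) + b * (Q * R₂) ≤
      (1 + a + b) * (R₀ + P * R₁ + Q * R₂) := by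
    have h1 : 0 < P * R₁ := by positivity
    have h2 : 0 < Q * R₂ := by positivity
    have h3 : 0 ≤ (a + b) * R₀ + (1 + b) * (P * R₁) + (1 + a) * (Q * R₂) := by positivity
    linarith
  refine (mul_le_mul_of_nonneg_left (mul_le_mul_of_nonneg_left hcmp hK0)
    (inv_nonneg.2 hΓ.le)).trans (le_of_eq ?_)
  rw [hK]
  ring
end
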